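/- If there exists a hyperentangled unit vector in H = H₁ ⊗ ⋯ ⊗ Hₙ (n > 1, each H_i separable of dimension > 1), then all the factor spaces H₁,…,Hₙ have the same Hilbert dimension, and if n > 2 this common dimension is infinite (hence countably infinite, by separability). -/

import Mathlib

open scoped InnerProductSpace

noncomputable section

/-- The (completed) Hilbert tensor product `H = H₁ ⊗ ⋯ ⊗ Hₙ` of a finite family of complex
Hilbert spaces `Hs i`, presented as a Hilbert space `H` together with a multilinear map
`tmul` (elementary tensors) whose inner products multiply, whose elementary tensors span a
dense subspace, and together with, for each factor `i`, the embedding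
`A ↦ A ⊗ (identity on the other factors)` of the bounded operators on `Hs i`. -/
structure MultiTensor (ι : Type*) [Fintype ι] [DecidableEq ι] (Hs : ι → Type*) (H : Type*)
    [∀ i, NormedAddCommGroup (Hs i)] [∀ i, InnerProductSpace ℂ (Hs i)]
    [∀ i, CompleteSpace (Hs i)]
    [NormedAddCommGroup H] [InnerProductSpace ℂ H] [CompleteSpace H] where
  tmul : MultilinearMap ℂ Hs H
  inner_tmul : ∀ x y, ⟪tmul x, tmul y⟫_ℂ = ∏ i, ⟪x i, y i⟫_ℂ
  dense_span : Dense (↑(Submodule.span ℂ (Set.range tmul)) : Set H)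
  embed : ∀ i, (Hs i →L[ℂ] Hs i) → (H →L[ℂ] H)
  embed_tmul : ∀ i A x, embed i A (tmul x) = tmul (Function.update x i (A (x i)))

variable {ι : Type*} [Fintype ι] [DecidableEq ι] {Hs : ι → Type*} {H : Type*}
    [∀ i, NormedAddCommGroup (Hs i)] [∀ i, InnerProductSpace ℂ (Hs i)]
    [∀ i, CompleteSpace (Hs i)]
    [NormedAddCommGroup H] [InnerProductSpace ℂ H] [CompleteSpace H]

/-- The von Neumann algebra of the subsystem `S`: the double commutant (in the bounded
operators on `H`) of the operators of the form `A ⊗ I` with `A` a bounded operator on a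
factor `Hs i`, `i ∈ S`.  (It consists of the operators `B ⊗ I` with `B` bounded on `H_S`.) -/
def MultiTensor.alg (T : MultiTensor ι Hs H) (S : Set ι) : Set (H →L[ℂ] H) :=
  Set.centralizer (Set.centralizer (⋃ i ∈ S, Set.range (T.embed i)))

/-- An orthogonal projection on a Hilbert space: a self-adjoint idempotent bounded operator. -/
def IsONProj {E : Type*} [NormedAddCommGroup E] [InnerProductSpace ℂ E] [CompleteSpace E]
    (P : E →L[ℂ] E) : Prop :=
  IsSelfAdjoint P ∧ P ∘L P = P

/-- The algebra of the subsystem `S` is maximally correlated with the algebra of the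
subsystem `S'` in the state `v`: for every nonzero orthogonal projection `P'` of the algebra
of `S` and every `ε > 0` there is a nonzero orthogonal projection `P` of the algebra of `S'`
with `⟪v, P v⟫ > 0` and `⟪v, P' P v⟫ ≥ (1 - ε) ⟪v, P v⟫`. -/
def MultiTensor.MaxCorr (T : MultiTensor ι Hs H) (S S' : Set ι) (v : H) : Prop :=
  ∀ P' ∈ T.alg S, IsONProj P' → P' ≠ 0 → ∀ ε : ℝ, 0 < ε →
    ∃ P ∈ T.alg S', IsONProj P ∧ P ≠ 0 ∧
      0 < (⟪v, P v⟫_ℂ).re ∧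
      (1 - ε) * (⟪v, P v⟫_ℂ).re ≤ (⟪v, P' (P v)⟫_ℂ).re

/-- `v` is hyperentangled: for all disjoint nonempty subsystems `S`, `S'` of `{1,…,n}`, the
algebra of `S` is maximally correlated with the algebra of `S'` in `v`. -/
def MultiTensor.Hyper (T : MultiTensor ι Hs H) (v : H) : Prop :=
  ∀ S S' : Set ι, S.Nonempty → S'.Nonempty → Disjoint S S' → T.MaxCorr S S' v


universe u

namespace MultiTensor

open InnerProductSpace

variable (T : MultiTensor ι Hs H)

/-- Bounded operators agreeing on elementary tensors are equal. -/
theorem ext_tmul {A B : H →L[ℂ] H} (h : ∀ x, A (T.tmul x) = B (T.tmul x)) : A = B := by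
  refine ContinuousLinearMap.ext_on T.dense_span ?_
  rintro _ ⟨x, rfl⟩
  exact h x

theorem embed_mul (i : ι) (A B : Hs i →L[ℂ] Hs i) :
    T.embed i (A * B) = T.embed i A * T.embed i B :=
  T.ext_tmul fun x => by simp [T.embed_tmul]

theorem embed_one (i : ι) : T.embed i 1 = 1 :=
  T.ext_tmul fun x => by simp [T.embed_tmul]

theorem embed_smul (i : ι) (c : ℂ) (A : Hs i →L[ℂ] Hs i) :
    T.embed i (c • A) = c • T.embed i A :=
  T.ext_tmul fun x => by simp [T.embed_tmul]

theorem embed_sum {α : Type*} (s : Finset α) (i : ι) (A : α → Hs i →L[ℂ] Hs i) :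
    T.embed i (∑ a ∈ s, A a) = ∑ a ∈ s, T.embed i (A a) :=
  T.ext_tmul fun x => by
    simp [T.embed_tmul, MultilinearMap.map_update_sum]

theorem embed_commute {i k : ι} (hik : i ≠ k) (A : Hs i →L[ℂ] Hs i) (B : Hs k →L[ℂ] Hs k) :
    T.embed i A * T.embed k B = T.embed k B * T.embed i A :=
  T.ext_tmul fun x => by
    simp [T.embed_tmul, Function.update_of_ne hik, Function.update_of_ne hik.symm,
      Function.update_comm hik]

theorem inner_tmul_update (i : ι) (x y : ∀ i, Hs i) (a : Hs i) :
    ⟪T.tmul (Function.update x i a), T.tmul y⟫_ℂ =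
      ⟪a, y i⟫_ℂ * ∏ k ∈ Finset.univ.erase i, ⟪x k, y k⟫_ℂ := by
  rw [T.inner_tmul, ← Finset.mul_prod_erase _ _ (Finset.mem_univ i), Function.update_self]
  congr 1
  refine Finset.prod_congr rfl fun k hk => ?_
  rw [Function.update_of_ne (Finset.ne_of_mem_erase hk)]

theorem embed_star (i : ι) (A : Hs i →L[ℂ] Hs i) :
    T.embed i (star A) = star (T.embed i A) := by
  refine T.ext_tmul fun x => ?_
  refine T.dense_span.eq_of_inner_right (𝕜 := ℂ) fun z hz => ?_
  induction hz using Submodule.span_induction with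
  | mem z hz =>
    obtain ⟨y, rfl⟩ := hz
    rw [ContinuousLinearMap.star_eq_adjoint, ContinuousLinearMap.star_eq_adjoint,
      ContinuousLinearMap.adjoint_inner_right, T.embed_tmul, T.embed_tmul,
      T.inner_tmul_update, ← inner_conj_symm, T.inner_tmul_update,
      ContinuousLinearMap.adjoint_inner_left, map_mul, map_prod, inner_conj_symm]
    simp only [inner_conj_symm]
  | zero => simp
  | add a b _ _ ha hb => simp [inner_add_left, ha, hb]
  | smul c a _ ha => simp [inner_smul_left, ha]

theorem embed_rankOne_mul (i : ι) (x y z w : Hs i) :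
    T.embed i (rankOne ℂ x y) * T.embed i (rankOne ℂ z w) =
      ⟪y, z⟫_ℂ • T.embed i (rankOne ℂ x w) := by
  rw [← T.embed_mul, ← T.embed_smul]
  congr 1
  exact rankOne_comp_rankOne x y z w

theorem star_embed_rankOne (i : ι) (x y : Hs i) :
    star (T.embed i (rankOne ℂ x y)) = T.embed i (rankOne ℂ y x) := by
  rw [← T.embed_star, ContinuousLinearMap.star_eq_adjoint, adjoint_rankOne]

theorem inner_embed_rankOne_left (i : ι) (x y : Hs i) (u w : H) :
    ⟪T.embed i (rankOne ℂ x y) u, w⟫_ℂ = ⟪u, T.embed i (rankOne ℂ y x) w⟫_ℂ := by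
  rw [← T.star_embed_rankOne i x y, ContinuousLinearMap.star_eq_adjoint,
    ContinuousLinearMap.adjoint_inner_right]

/-- A vector fixed by the one-dimensional projections onto unit vectors `x i` in all factors is
a multiple of the elementary tensor of the `x i`. -/
theorem eq_smul_tmul_of_fixed {x : ∀ i, Hs i} {w : H}
    (hw : ∀ i, T.embed i (rankOne ℂ (x i) (x i)) w = w) :
    w = ⟪T.tmul x, w⟫_ℂ • T.tmul x := by
  have key (y : ∀ i, Hs i) (s : Finset ι) :
      ⟪T.tmul y, w⟫_ℂ = (∏ i ∈ s, ⟪y i, x i⟫_ℂ) * ⟪T.tmul (s.piecewise x y), w⟫_ℂ := by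
    induction s using Finset.induction_on with
    | empty => simp
    | insert i s hi ih =>
      rw [ih, ← hw i, ← T.inner_embed_rankOne_left, hw i, T.embed_tmul, rankOne_apply,
        T.tmul.map_update_smul, inner_smul_left, inner_conj_symm, Finset.piecewise_insert,
        Finset.prod_insert hi, Finset.piecewise_eq_of_notMem _ _ _ hi]
      ring
  refine T.dense_span.eq_of_inner_right (𝕜 := ℂ) fun z hz => ?_
  induction hz using Submodule.span_induction with
  | mem z hz =>
    obtain ⟨y, rfl⟩ := hz
    rw [key y Finset.univ, Finset.piecewise_univ, inner_smul_right, T.inner_tmul y x, mul_comm]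
  | zero => simp
  | add a b _ _ ha hb => rw [inner_add_left, inner_add_left, ha, hb]
  | smul c a _ ha => rw [inner_smul_left, inner_smul_left, ha]

/-- An operator commuting with all one-factor operators is a scalar. -/
theorem exists_eq_smul_one [∀ i, Nontrivial (Hs i)] {c : H →L[ℂ] H}
    (hc : ∀ i A, T.embed i A * c = c * T.embed i A) : ∃ μ : ℂ, c = μ • 1 := by
  have hcapp (i : ι) (A : Hs i →L[ℂ] Hs i) (u : H) : T.embed i A (c u) = c (T.embed i A u) :=
    DFunLike.congr_fun (hc i A) u
  choose x hx using fun i => exists_norm_eq (Hs i) zero_le_one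
  have hxx (i : ι) : ⟪x i, x i⟫_ℂ = 1 := by simp [inner_self_eq_norm_sq_to_K, hx]
  have hfix : c (T.tmul x) = ⟪T.tmul x, c (T.tmul x)⟫_ℂ • T.tmul x :=
    T.eq_smul_tmul_of_fixed fun i => by
      rw [hcapp, T.embed_tmul, rankOne_apply, hxx, one_smul, Function.update_eq_self]
  refine ⟨⟪T.tmul x, c (T.tmul x)⟫_ℂ, T.ext_tmul fun y => ?_⟩
  generalize ⟪T.tmul x, c (T.tmul x)⟫_ℂ = μ at hfix
  suffices h : ∀ s : Finset ι, c (T.tmul (s.piecewise y x)) = μ • T.tmul (s.piecewise y x) by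
    simpa using h Finset.univ
  intro s
  induction s using Finset.induction_on with
  | empty => simpa using hfix
  | insert i s hi ih =>
    have hmove : T.tmul ((insert i s).piecewise y x) =
        T.embed i (rankOne ℂ (y i) (x i)) (T.tmul (s.piecewise y x)) := by
      rw [T.embed_tmul, Finset.piecewise_eq_of_notMem _ _ _ hi, rankOne_apply, hxx, one_smul,
        Finset.piecewise_insert]
    rw [hmove, ← hcapp, ih, map_smul]

theorem embed_mem_alg {S : Set ι} {i : ι} (hi : i ∈ S) (A : Hs i →L[ℂ] Hs i) :
    T.embed i A ∈ T.alg S :=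
  Set.subset_centralizer_centralizer (Set.mem_biUnion hi ⟨A, rfl⟩)

theorem embed_mem_centralizer {S : Set ι} {i : ι} (hi : i ∉ S) (A : Hs i →L[ℂ] Hs i) :
    T.embed i A ∈ Set.centralizer (⋃ k ∈ S, Set.range (T.embed k)) := by
  intro B hB
  obtain ⟨k, hk, B, rfl⟩ := Set.mem_iUnion₂.1 hB
  exact T.embed_commute (ne_of_mem_of_not_mem hk hi) B A

/-- Compressing an operator of the algebra of `{j}` by rank-one operators of the factor `j`. -/
theorem exists_embed_rankOne_mul [∀ i, Nontrivial (Hs i)] {j : ι} {J : Type*} [Fintype J]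
    (b : OrthonormalBasis J ℂ (Hs j)) (o : J) {P : H →L[ℂ] H} (hP : P ∈ T.alg {j}) (a : J) :
    ∃ μ : J → ℂ, T.embed j (rankOne ℂ (b o) (b a)) * P =
      ∑ k, μ k • T.embed j (rankOne ℂ (b o) (b k)) := by
  classical
  set E : J → J → H →L[ℂ] H := fun k l => T.embed j (rankOne ℂ (b k) (b l)) with hE
  have hEE (k l m n : J) : E k l * E m n = if l = m then E k n else 0 := by
    rw [hE]
    simp only [T.embed_rankOne_mul, b.inner_eq_ite, ite_smul, one_smul, zero_smul]
  have hE1 : ∑ k, E k k = 1 := by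
    rw [hE, ← T.embed_sum, b.sum_rankOne_eq_id]
    exact T.embed_one j
  have hscalar (k : J) : ∃ μ : ℂ, ∑ l, E l a * P * E k l = μ • 1 := by
    refine T.exists_eq_smul_one fun i A => ?_
    by_cases hij : i = j
    · subst hij
      have hcomm (m n : J) : E m n * (∑ l, E l a * P * E k l) =
          (∑ l, E l a * P * E k l) * E m n := by
        simp_rw [Finset.mul_sum, Finset.sum_mul, ← mul_assoc, hEE, mul_assoc, hEE]
        simp
      have hA : T.embed i A = ∑ m, ∑ n, ⟪b n, A (b m)⟫_ℂ • E n m := by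
        have : A = ∑ m, ∑ n, ⟪b n, A (b m)⟫_ℂ • rankOne ℂ (b n) (b m) := by
          ext z
          simp only [sum_apply, smul_apply,
            rankOne_apply]
          conv_lhs => rw [← b.sum_repr' z, map_sum]
          refine Finset.sum_congr rfl fun m _ => ?_
          conv_lhs => rw [map_smul, ← b.sum_repr' (A (b m)), Finset.smul_sum]
          exact Finset.sum_congr rfl fun n _ => smul_comm _ _ _
        conv_lhs => rw [this]
        simp_rw [T.embed_sum, T.embed_smul]
        rfl
      rw [hA]
      generalize ∑ l, E l a * P * E k l = c at hcomm
      simp_rw [Finset.sum_mul, smul_mul_assoc, hcomm, Finset.mul_sum, mul_smul_comm]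
    · have hcen := T.embed_mem_centralizer (S := {j}) (i := i) (by simpa using hij) A
      have hPc : T.embed i A * P = P * T.embed i A := hP _ hcen
      have hEc (m n : J) : T.embed i A * E m n = E m n * T.embed i A := T.embed_commute hij _ _
      rw [Finset.mul_sum, Finset.sum_mul]
      refine Finset.sum_congr rfl fun l _ => ?_
      rw [← mul_assoc, ← mul_assoc, hEc, mul_assoc (E l a), hPc, mul_assoc, mul_assoc, hEc]
      simp only [mul_assoc]
  choose μ hμ using hscalar
  refine ⟨μ, ?_⟩
  calc E o a * P = E o a * P * ∑ k, E k k := by rw [hE1, mul_one]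
    _ = ∑ k, μ k • E o k := by
      rw [Finset.mul_sum]
      refine Finset.sum_congr rfl fun k _ => ?_
      calc E o a * P * E k k = (∑ l, E l a * P * E k l) * E o k := by
            simp_rw [Finset.sum_mul, mul_assoc, hEE]
            simp
        _ = μ k • E o k := by rw [hμ, smul_mul_assoc, one_mul]

theorem sum_norm_sq_embed_rankOne {j : ι} {J : Type*} [Fintype J]
    (b : OrthonormalBasis J ℂ (Hs j)) (o : J) (z : H) :
    ∑ a, ‖T.embed j (rankOne ℂ (b o) (b a)) z‖ ^ 2 = ‖z‖ ^ 2 := by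
  have hE1 : ∑ k, T.embed j (rankOne ℂ (b k) (b k)) = 1 := by
    rw [← T.embed_sum, b.sum_rankOne_eq_id]
    exact T.embed_one j
  have h : ∑ a, ⟪T.embed j (rankOne ℂ (b o) (b a)) z, T.embed j (rankOne ℂ (b o) (b a)) z⟫_ℂ =
      ⟪z, z⟫_ℂ := by
    have h1 (a : J) : ⟪T.embed j (rankOne ℂ (b o) (b a)) z,
        T.embed j (rankOne ℂ (b o) (b a)) z⟫_ℂ = ⟪z, T.embed j (rankOne ℂ (b a) (b a)) z⟫_ℂ := by
      rw [T.inner_embed_rankOne_left, ← mul_apply_eq_comp, T.embed_rankOne_mul,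
        inner_self_eq_norm_sq_to_K, b.orthonormal.1]
      simp
    simp_rw [h1, ← inner_sum, ← sum_apply, hE1,
      one_apply_eq_self]
  simp_rw [inner_self_eq_norm_sq_to_K] at h
  exact_mod_cast h

end MultiTensor

theorem IsONProj.inner_apply_self {P : H →L[ℂ] H} (hP : IsONProj P) (v : H) :
    ⟪v, P v⟫_ℂ = ⟪P v, P v⟫_ℂ := by
  rw [← ContinuousLinearMap.adjoint_inner_right, ← ContinuousLinearMap.star_eq_adjoint, hP.1.star_eq]
  conv_lhs => rw [← hP.2]
  rfl

theorem IsONProj.norm_sq_sub {P : H →L[ℂ] H} (hP : IsONProj P) (v : H) :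
    ‖v - P v‖ ^ 2 = ‖v‖ ^ 2 - ‖P v‖ ^ 2 := by
  have h : RCLike.re ⟪v, P v⟫_ℂ = ‖P v‖ ^ 2 := by
    rw [hP.inner_apply_self, inner_self_eq_norm_sq]
  rw [@norm_sub_sq ℂ, h]
  ring

namespace MultiTensor

open InnerProductSpace

variable (T : MultiTensor ι Hs H)

/-- If the algebra of `S` is maximally correlated with that of a factor `j ∉ S` of finite
dimension, then every nonzero projection of the algebra of `S` fixes a nonzero vector of the
finite-dimensional space of partial contractions of `v` along the factor `j`. -/
theorem MaxCorr.exists_fixed [∀ i, Nontrivial (Hs i)] {S : Set ι} {j : ι} {v : H}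
    (h : T.MaxCorr S {j} v) (hj : j ∉ S) {J : Type*} [Fintype J]
    (b : OrthonormalBasis J ℂ (Hs j)) (o : J) {Q : H →L[ℂ] H} (hQS : Q ∈ T.alg S)
    (hQ : IsONProj Q) (hQ0 : Q ≠ 0) :
    ∃ y ∈ Submodule.span ℂ (Set.range fun a => T.embed j (rankOne ℂ (b o) (b a)) v),
      y ≠ 0 ∧ Q y = y := by
  set R := Submodule.span ℂ (Set.range fun a => T.embed j (rankOne ℂ (b o) (b a)) v) with hR
  have : FiniteDimensional ℂ R := FiniteDimensional.span_of_finite ℂ (Set.finite_range _)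
  by_contra! hno
  let f : R →ₗ[ℂ] H := ((1 - Q : H →L[ℂ] H) : H →ₗ[ℂ] H).comp R.subtype
  have hf : LinearMap.ker f = ⊥ := by
    rw [LinearMap.ker_eq_bot']
    intro y hy
    by_contra hy0
    refine hno y y.2 (by simpa using hy0) ?_
    have : (y : H) - Q y = 0 := hy
    exact (sub_eq_zero.1 this).symm
  obtain ⟨K, -, hK⟩ := f.exists_antilipschitzWith hf
  have hbound (y : H) (hy : y ∈ R) : ‖y‖ ^ 2 ≤ (K : ℝ) ^ 2 * ‖y - Q y‖ ^ 2 := by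
    rw [← mul_pow]
    exact pow_le_pow_left₀ (norm_nonneg _) (ZeroHomClass.bound_of_antilipschitz f hK ⟨y, hy⟩) 2
  obtain ⟨P, hPj, hP, -, hpos, hle⟩ := h Q hQS hQ hQ0 (1 / (2 * ((K : ℝ) ^ 2 + 1))) (by positivity)
  have hQcen : Q ∈ Set.centralizer (⋃ k ∈ ({j} : Set ι), Set.range (T.embed k)) := by
    intro B hB
    obtain ⟨k, hk, B, rfl⟩ := Set.mem_iUnion₂.1 hB
    obtain rfl : k = j := hk
    exact hQS _ (T.embed_mem_centralizer hj B)
  have hQP : Q * P = P * Q := hPj _ hQcen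
  have hQE (a : J) (u : H) : T.embed j (rankOne ℂ (b o) (b a)) (Q u) =
      Q (T.embed j (rankOne ℂ (b o) (b a)) u) :=
    DFunLike.congr_fun (hQcen _ (Set.mem_biUnion (Set.mem_singleton j) ⟨_, rfl⟩)) u
  set z := P v with hz
  have hzz : (⟪v, z⟫_ℂ).re = ‖z‖ ^ 2 := by
    rw [hz, hP.inner_apply_self]
    exact inner_self_eq_norm_sq (𝕜 := ℂ) _
  have hQz : (⟪v, Q z⟫_ℂ).re = ‖Q z‖ ^ 2 := by
    have hPQz : P (Q z) = Q z := by
      have h1 := DFunLike.congr_fun hQP (P v)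
      have h2 := DFunLike.congr_fun hP.2 v
      simp only [mul_apply_eq_comp, ContinuousLinearMap.comp_apply] at h1 h2
      rw [hz, ← h1, h2]
    rw [← hPQz, ← ContinuousLinearMap.adjoint_inner_left, ← ContinuousLinearMap.star_eq_adjoint,
      hP.1.star_eq, ← hz, hPQz, hQ.inner_apply_self]
    exact inner_self_eq_norm_sq (𝕜 := ℂ) _
  rw [hzz] at hpos
  rw [hzz, hQz] at hle
  have hmem (a : J) : T.embed j (rankOne ℂ (b o) (b a)) z ∈ R := by
    obtain ⟨μ, hμ⟩ := T.exists_embed_rankOne_mul b o hPj a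
    have hμv := DFunLike.congr_fun hμ v
    rw [mul_apply_eq_comp, sum_apply] at hμv
    rw [hz, hμv]
    exact Submodule.sum_mem _ fun k _ => Submodule.smul_mem _ _ (Submodule.subset_span ⟨k, rfl⟩)
  have hfinal : ‖z‖ ^ 2 ≤ (K : ℝ) ^ 2 * ‖z - Q z‖ ^ 2 := by
    rw [← T.sum_norm_sq_embed_rankOne b o z, ← T.sum_norm_sq_embed_rankOne b o (z - Q z),
      Finset.mul_sum]
    refine Finset.sum_le_sum fun a _ => ?_
    rw [map_sub, hQE]
    exact hbound _ (hmem a)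
  rw [hQ.norm_sq_sub] at hfinal
  have hK1 : (K : ℝ) ^ 2 * (1 / (2 * ((K : ℝ) ^ 2 + 1))) ≤ 1 / 2 := by
    rw [mul_one_div, div_le_div_iff₀ (by positivity) two_pos]
    linarith
  nlinarith [mul_le_mul_of_nonneg_right hK1 hpos.le,
    mul_le_mul_of_nonneg_left hle (sq_nonneg (K : ℝ))]

/-- Under maximal correlation of `S` with a factor of finite dimension `d`, the algebra of `S`
contains at most `d` mutually orthogonal nonzero projections. -/
theorem MaxCorr.card_le [∀ i, Nontrivial (Hs i)] {S : Set ι} {j : ι} {v : H}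
    (h : T.MaxCorr S {j} v) (hj : j ∉ S) {J : Type*} [Fintype J]
    (b : OrthonormalBasis J ℂ (Hs j)) {α : Type*} [Fintype α] {Q : α → H →L[ℂ] H}
    (hQS : ∀ k, Q k ∈ T.alg S) (hQ : ∀ k, IsONProj (Q k)) (hQ0 : ∀ k, Q k ≠ 0)
    (horth : Pairwise fun k l => Q k * Q l = 0) : Fintype.card α ≤ Fintype.card J := by
  have : Nonempty J := b.toBasis.index_nonempty
  obtain ⟨o⟩ := ‹Nonempty J›
  choose y hyR hy0 hQy using fun k => h.exists_fixed T hj b o (hQS k) (hQ k) (hQ0 k)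
  have hlin : LinearIndependent ℂ y := by
    refine linearIndependent_of_ne_zero_of_inner_eq_zero hy0 fun k l hkl => ?_
    change ⟪y k, y l⟫_ℂ = 0
    rw [← hQy k, ← ContinuousLinearMap.adjoint_inner_right, ← ContinuousLinearMap.star_eq_adjoint,
      (hQ k).1.star_eq, ← hQy l, ← mul_apply_eq_comp, horth hkl]
    simp
  calc Fintype.card α
      ≤ Module.finrank ℂ (Submodule.span ℂ
          (Set.range fun a => T.embed j (rankOne ℂ (b o) (b a)) v)) := by
        have := FiniteDimensional.span_of_finite ℂ
          (Set.finite_range fun a => T.embed j (rankOne ℂ (b o) (b a)) v)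
        have hlin' : LinearIndependent ℂ fun k => (⟨y k, hyR k⟩ : Submodule.span ℂ
          (Set.range fun a => T.embed j (rankOne ℂ (b o) (b a)) v)) :=
          LinearIndependent.of_comp (Submodule.subtype _) hlin
        exact hlin'.fintype_card_le_finrank
    _ ≤ Fintype.card J := finrank_range_le_card _

theorem isONProj_embed_rankOne (i : ι) {x : Hs i} (hx : ‖x‖ = 1) :
    IsONProj (T.embed i (rankOne ℂ x x)) := by
  refine ⟨T.star_embed_rankOne i x x, ?_⟩
  have := T.embed_rankOne_mul i x x x x
  rwa [inner_self_eq_norm_sq_to_K, hx, RCLike.ofReal_one, one_pow, one_smul] at this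

theorem tmul_ne_zero {x : ∀ i, Hs i} (hx : ∀ i, x i ≠ 0) : T.tmul x ≠ 0 := by
  rw [← inner_self_ne_zero (𝕜 := ℂ), T.inner_tmul]
  exact Finset.prod_ne_zero_iff.2 fun i _ => inner_self_ne_zero.2 (hx i)

/-- Orthonormal families of the factor `i` are no larger than the dimension of a
finite-dimensional factor `j`. -/
theorem Hyper.card_le [∀ i, Nontrivial (Hs i)] {v : H} (h : T.Hyper v) {i j : ι}
    {J : Type*} [Fintype J] (b : OrthonormalBasis J ℂ (Hs j)) {α : Type*} [Fintype α]
    {e : α → Hs i} (he : Orthonormal ℂ e) : Fintype.card α ≤ Fintype.card J := by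
  obtain rfl | hij := eq_or_ne i j
  · have := b.toBasis.finiteDimensional_of_finite
    rw [← Module.finrank_eq_card_basis b.toBasis]
    exact he.linearIndependent.fintype_card_le_finrank
  refine MaxCorr.card_le T (h {i} {j} (Set.singleton_nonempty i) (Set.singleton_nonempty j)
    (Set.disjoint_singleton.2 hij)) (fun hji => hij (Set.mem_singleton_iff.1 hji).symm) b
    (Q := fun k => T.embed i (rankOne ℂ (e k) (e k)))
    (fun k => T.embed_mem_alg (Set.mem_singleton i) _)
    (fun k => T.isONProj_embed_rankOne i (he.1 k)) (fun k h0 => ?_) (fun k l hkl => ?_)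
  · choose x hx using fun i => exists_ne (0 : Hs i)
    have hek : e k ≠ 0 := he.ne_zero k
    refine T.tmul_ne_zero (x := Function.update x i (e k)) (fun m => ?_) ?_
    · by_cases hm : m = i
      · subst hm
        simpa using hek
      · simpa [hm] using hx m
    · have := DFunLike.congr_fun h0 (T.tmul (Function.update x i (e k)))
      simpa [T.embed_tmul, inner_self_eq_norm_sq_to_K, he.1 k] using this
  · simp only [T.embed_rankOne_mul, he.2 hkl, zero_smul]

/-- The tensor product of two factors has dimension at most that of a finite-dimensional third
factor. -/
theorem Hyper.card_mul_card_le [∀ i, Nontrivial (Hs i)] {v : H} (h : T.Hyper v) {i j k : ι}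
    (hij : i ≠ j) (hik : i ≠ k) (hjk : j ≠ k) {J : Type*} [Fintype J]
    (b : OrthonormalBasis J ℂ (Hs i)) {α β : Type*} [Fintype α] [Fintype β]
    {e : α → Hs j} (he : Orthonormal ℂ e) {f : β → Hs k} (hf : Orthonormal ℂ f) :
    Fintype.card α * Fintype.card β ≤ Fintype.card J := by
  rw [← Fintype.card_prod]
  have hcomm (p q : α × β) :
      T.embed j (rankOne ℂ (e p.1) (e p.1)) * T.embed k (rankOne ℂ (f p.2) (f p.2)) *
        (T.embed j (rankOne ℂ (e q.1) (e q.1)) * T.embed k (rankOne ℂ (f q.2) (f q.2))) =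
      (T.embed j (rankOne ℂ (e p.1) (e p.1)) * T.embed j (rankOne ℂ (e q.1) (e q.1))) *
        (T.embed k (rankOne ℂ (f p.2) (f p.2)) * T.embed k (rankOne ℂ (f q.2) (f q.2))) :=
    Commute.mul_mul_mul_comm (T.embed_commute hjk.symm _ _) _ _
  refine MaxCorr.card_le T (h {j, k} {i} (Set.insert_nonempty _ _) (Set.singleton_nonempty i)
    (by simp [hij, hik])) (by simp [hij, hik]) b
    (Q := fun p : α × β => T.embed j (rankOne ℂ (e p.1) (e p.1)) *
      T.embed k (rankOne ℂ (f p.2) (f p.2)))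
    (fun p => Set.mul_mem_centralizer (T.embed_mem_alg (by simp) _) (T.embed_mem_alg (by simp) _))
    (fun p => ⟨?_, ?_⟩) (fun p h0 => ?_) (fun p q hpq => ?_)
  · have hj := (T.isONProj_embed_rankOne j (he.1 p.1)).1
    have hk := (T.isONProj_embed_rankOne k (hf.1 p.2)).1
    rw [IsSelfAdjoint, star_mul, hj.star_eq, hk.star_eq]
    exact T.embed_commute hjk.symm _ _
  · have hj := (T.isONProj_embed_rankOne j (he.1 p.1)).2
    have hk := (T.isONProj_embed_rankOne k (hf.1 p.2)).2
    rw [← ContinuousLinearMap.mul_def] at hj hk ⊢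
    rw [hcomm, hj, hk]
  · choose x hx using fun i => exists_ne (0 : Hs i)
    have hej : e p.1 ≠ 0 := he.ne_zero p.1
    have hfk : f p.2 ≠ 0 := hf.ne_zero p.2
    refine T.tmul_ne_zero
      (x := Function.update (Function.update x j (e p.1)) k (f p.2)) (fun m => ?_) ?_
    · by_cases hmk : m = k
      · subst hmk
        simpa using hfk
      · by_cases hmj : m = j
        · subst hmj
          simpa [hmk] using hej
        · simpa [hmk, hmj] using hx m
    · have := DFunLike.congr_fun h0
        (T.tmul (Function.update (Function.update x j (e p.1)) k (f p.2)))
      simpa [T.embed_tmul, inner_self_eq_norm_sq_to_K, he.1, hf.1, hjk,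
        Function.update_comm hjk.symm] using this
  · change T.embed j _ * T.embed k _ * (T.embed j _ * T.embed k _) = 0
    rw [hcomm, T.embed_rankOne_mul, T.embed_rankOne_mul]
    by_cases h1 : p.1 = q.1
    · rw [hf.2 fun h2 => hpq (Prod.ext h1 h2), zero_smul, mul_zero]
    · rw [he.2 h1, zero_smul, zero_mul]

/-- Every factor has dimension at most that of a finite-dimensional factor. -/
theorem Hyper.finite_and_card_le [∀ i, Nontrivial (Hs i)] {v : H} (h : T.Hyper v) {i j : ι}
    {I J : Type*} [Finite J] (bj : HilbertBasis J ℂ (Hs j))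
    (bi : HilbertBasis I ℂ (Hs i)) : Finite I ∧ Nat.card I ≤ Nat.card J := by
  have := Fintype.ofFinite J
  have hI : Finite I := by
    by_contra hI
    have := not_finite_iff_infinite.1 hI
    obtain ⟨s, hs⟩ := Infinite.exists_subset_card_eq I (Fintype.card J + 1)
    have := h.card_le T bj.toOrthonormalBasis
      (bi.orthonormal.comp ((↑) : s → I) Subtype.coe_injective)
    rw [Fintype.card_coe, hs] at this
    omega
  have := Fintype.ofFinite I
  refine ⟨hI, ?_⟩
  rw [Nat.card_eq_fintype_card, Nat.card_eq_fintype_card]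
  exact h.card_le T bj.toOrthonormalBasis bi.orthonormal

end MultiTensor

/-- An orthonormal family in a separable inner product space is countable. -/
theorem Orthonormal.countable_of_separableSpace {E : Type*} [NormedAddCommGroup E]
    [InnerProductSpace ℂ E] [TopologicalSpace.SeparableSpace E] {α : Type*} {e : α → E}
    (he : Orthonormal ℂ e) : Countable α := by
  refine Pairwise.countable_of_isOpen_disjoint (s := fun a => Metric.ball (e a) (1 / 2))
    (fun a c hac => ?_) (fun a => Metric.isOpen_ball)
    (fun a => ⟨e a, Metric.mem_ball_self one_half_pos⟩)
  refine Metric.ball_disjoint_ball ?_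
  have h : ‖e a - e c‖ ^ 2 = 2 := by
    rw [@norm_sub_sq ℂ, he.1, he.1, he.2 hac]
    norm_num
  rw [dist_eq_norm]
  nlinarith [norm_nonneg (e a - e c)]

/-- if there is a hyperentangled unit vector in `H = H₁ ⊗ ⋯ ⊗ Hₙ` (`n > 1`,
each factor separable of dimension `> 1`), then all the factors have the same Hilbert
dimension, and if `n > 2` this common dimension is (countably) infinite. -/
theorem exists_hyper_imp_dims_eq_and_infinite
    [∀ i, TopologicalSpace.SeparableSpace (Hs i)]
    (hn : 1 < Fintype.card ι) (hdim : ∀ i, 1 < Module.rank ℂ (Hs i))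
    (T : MultiTensor ι Hs H) (hex : ∃ v : H, ‖v‖ = 1 ∧ T.Hyper v) :
    (∀ (i j : ι) (Ji Jj : Type u)
      (bi : HilbertBasis Ji ℂ (Hs i)) (bj : HilbertBasis Jj ℂ (Hs j)),
        Cardinal.mk Ji = Cardinal.mk Jj) ∧
    (2 < Fintype.card ι →
      ∀ (i : ι) (Ji : Type u) (bi : HilbertBasis Ji ℂ (Hs i)),
        Cardinal.mk Ji = Cardinal.aleph0) := by
  obtain ⟨v, -, hv⟩ := hex
  have (i : ι) : Nontrivial (Hs i) :=
    rank_pos_iff_nontrivial.1 (zero_lt_one.trans (hdim i))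
  have hinf {i : ι} {I : Type u} (b : HilbertBasis I ℂ (Hs i)) (hI : ¬ Finite I) :
      Cardinal.mk I = Cardinal.aleph0 := by
    have := not_finite_iff_infinite.1 hI
    have := b.orthonormal.countable_of_separableSpace
    exact Cardinal.mk_eq_aleph0 I
  refine ⟨fun i j Ji Jj bi bj => ?_, fun hn2 i Ji bi => hinf bi ?_⟩
  · by_cases hJ : Finite Ji
    · obtain ⟨hJj, h1⟩ := hv.finite_and_card_le T bi bj
      obtain ⟨-, h2⟩ := hv.finite_and_card_le T bj bi
      rw [← Nat.cast_card, ← Nat.cast_card, le_antisymm h2 h1]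
    · rw [hinf bi hJ, hinf bj fun hJj => hJ (hv.finite_and_card_le T bj bi).1]
  · intro hJ
    obtain ⟨j, hji⟩ := Fintype.exists_ne_of_one_lt_card hn i
    obtain ⟨k, hki, hkj⟩ : ∃ k, k ≠ i ∧ k ≠ j := by
      obtain ⟨k, hk⟩ := Finset.exists_mem_notMem_of_card_lt_card
        (s := ({i, j} : Finset ι)) (t := Finset.univ) (Finset.card_le_two.trans_lt hn2)
      exact ⟨k, by simpa using hk⟩
    obtain ⟨wj, bj, -⟩ := exists_hilbertBasis ℂ (Hs j)
    obtain ⟨wk, bk, -⟩ := exists_hilbertBasis ℂ (Hs k)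
    obtain ⟨hwj, -⟩ := hv.finite_and_card_le T bi bj
    obtain ⟨hwk, -⟩ := hv.finite_and_card_le T bi bk
    have hle := (hv.finite_and_card_le T bj bi).2
    have := Fintype.ofFinite Ji
    have := Fintype.ofFinite wj
    have := Fintype.ofFinite wk
    have hmul := hv.card_mul_card_le T hji.symm hki.symm hkj.symm bi.toOrthonormalBasis
      bj.orthonormal bk.orthonormal
    have hpos : 0 < Fintype.card wj :=
      Fintype.card_pos_iff.2 bj.toOrthonormalBasis.toBasis.index_nonempty
    have hk2 : 1 < Fintype.card wk := by
      have := hdim k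
      rw [rank_eq_card_basis bk.toOrthonormalBasis.toBasis] at this
      exact_mod_cast this
    rw [Nat.card_eq_fintype_card, Nat.card_eq_fintype_card] at hle
    nlinarith

end
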